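/- For every t₀ > 0 and r > 0 there exists a constant C = C(t₀, r) > 0 such that for all t ∈ (0, t₀] and all real numbers x, y ≥ r: C·|x − y| ≤ W(½(γ_x^t + γ_{−x}^t), ½(γ_y^t + γ_{−y}^t)), where W is the L²-Wasserstein distance on ℝ with the Euclidean distance. -/

import Mathlib

open MeasureTheory ENNReal

/-- A coupling of two measures: a measure on the product whose marginals are the two
given measures. -/
def IsCoupling {Y : Type*} [MeasurableSpace Y] (π : Measure (Y × Y)) (μ ν : Measure Y) : Prop :=
  π.map Prod.fst = μ ∧ π.map Prod.snd = ν

/-- The (squared) optimal transport cost for the quadratic cost built from `c`. -/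
noncomputable def transportCost {Y : Type*} [MeasurableSpace Y] (c : Y → Y → ℝ)
    (μ ν : Measure Y) : ℝ≥0∞ :=
  ⨅ (π : Measure (Y × Y)) (_ : IsCoupling π μ ν), ∫⁻ p, ENNReal.ofReal (c p.1 p.2 ^ 2) ∂π

/-- The `L²`-Wasserstein distance associated to the cost `c`. -/
noncomputable def W2 {Y : Type*} [MeasurableSpace Y] (c : Y → Y → ℝ) (μ ν : Measure Y) : ℝ :=
  Real.sqrt (transportCost c μ ν).toReal

/-- A measure on a metric space has finite second moment. -/
def HasFiniteSecondMoment {X : Type*} [MetricSpace X] [MeasurableSpace X] (μ : Measure X) :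
    Prop :=
  ∃ x₀ : X, ∫⁻ x, ENNReal.ofReal (dist x₀ x ^ 2) ∂μ < ⊤

/-- A partition `0 = s 0 < s 1 < ⋯ < s N = 1` of `[0,1]`. -/
def IsPartition (N : ℕ) (s : ℕ → ℝ) : Prop :=
  s 0 = 0 ∧ s N = 1 ∧ ∀ i < N, s i < s (i + 1)

/-- The length of the curve `γ : [0,1] → Y` with respect to the distance `ρ`, as the
supremum over partitions of sums of consecutive `ρ`-distances. -/
noncomputable def curveLength {Y : Type*} (ρ : Y → Y → ℝ) (γ : ℝ → Y) : ℝ≥0∞ :=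
  ⨆ (N : ℕ) (s : ℕ → ℝ) (_ : IsPartition N s),
    ENNReal.ofReal (∑ i ∈ Finset.range N, ρ (γ (s i)) (γ (s (i + 1))))

/-- Continuity of a curve `γ : [0,1] → Y` with respect to the distance `ρ`. -/
def RhoContinuousCurve {Y : Type*} (ρ : Y → Y → ℝ) (γ : ℝ → Y) : Prop :=
  ∀ s ∈ Set.Icc (0:ℝ) 1, ∀ ε > 0, ∃ δ > 0, ∀ s' ∈ Set.Icc (0:ℝ) 1,
    |s' - s| < δ → ρ (γ s) (γ s') < ε

/-- The length distance induced by the distance `ρ`. -/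
noncomputable def lengthDist {Y : Type*} (ρ : Y → Y → ℝ) (x y : Y) : ℝ≥0∞ :=
  ⨅ (γ : ℝ → Y) (_ : RhoContinuousCurve ρ γ ∧ γ 0 = x ∧ γ 1 = y), curveLength ρ γ

/-- A metric space is a length space: the distance coincides with the induced length
distance. -/
def IsLengthSpace (X : Type*) [MetricSpace X] : Prop :=
  ∀ x y : X, lengthDist (fun a b => dist a b) x y = ENNReal.ofReal (dist x y)

/-- The one-dimensional Gaussian measure with center `x` and variance `2t` (heat kernel
at time `t`). -/
noncomputable def gauss1 (t x : ℝ) : Measure ℝ :=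
  volume.withDensity fun y =>
    ENNReal.ofReal ((Real.sqrt (4 * Real.pi * t))⁻¹ * Real.exp (-(y - x) ^ 2 / (4 * t)))

/-- The symmetric mixture `½(γ_x^t + γ_{-x}^t)` of one-dimensional Gaussians. -/
noncomputable def symGauss1 (t x : ℝ) : Measure ℝ :=
  (2 : ℝ≥0∞)⁻¹ • (gauss1 t x + gauss1 t (-x))

theorem gauss1_eq_gaussianReal {t : ℝ} (ht : 0 < t) (x : ℝ) :
    gauss1 t x = ProbabilityTheory.gaussianReal x (2 * t).toNNReal := by
  have hv : (2 * t).toNNReal ≠ 0 := by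
    simpa [Real.toNNReal_eq_zero] using ht
  rw [ProbabilityTheory.gaussianReal_of_var_ne_zero _ hv, gauss1]
  congr 1
  funext y
  rw [ProbabilityTheory.gaussianPDF, ProbabilityTheory.gaussianPDFReal,
    Real.coe_toNNReal _ (by positivity)]
  ring_nf

theorem lintegral_sq_gaussianReal (m : ℝ) (v : NNReal) :
    ∫⁻ a, ENNReal.ofReal (a ^ 2) ∂(ProbabilityTheory.gaussianReal m v) =
      ENNReal.ofReal (m ^ 2 + v) := by
  have hL : MemLp (id : ℝ → ℝ) 2 (ProbabilityTheory.gaussianReal m v) :=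
    ProbabilityTheory.memLp_id_gaussianReal 2
  have hvar := ProbabilityTheory.variance_eq_sub hL
  rw [ProbabilityTheory.variance_id_gaussianReal] at hvar
  simp only [id_eq, Pi.pow_apply, ProbabilityTheory.integral_id_gaussianReal] at hvar
  rw [← ofReal_integral_eq_lintegral_ofReal (f := fun a : ℝ => a ^ 2) hL.integrable_sq
    (Filter.Eventually.of_forall fun a => sq_nonneg a)]
  congr 1
  linarith

theorem isProbabilityMeasure_symGauss1 {t : ℝ} (ht : 0 < t) (x : ℝ) :
    IsProbabilityMeasure (symGauss1 t x) := by
  constructor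
  rw [symGauss1, gauss1_eq_gaussianReal ht, gauss1_eq_gaussianReal ht]
  simp [ENNReal.inv_two_add_inv_two]

theorem lintegral_sq_symGauss1 {t : ℝ} (ht : 0 < t) (x : ℝ) :
    ∫⁻ a, ENNReal.ofReal (a ^ 2) ∂(symGauss1 t x) = ENNReal.ofReal (x ^ 2 + 2 * t) := by
  rw [symGauss1, gauss1_eq_gaussianReal ht, gauss1_eq_gaussianReal ht, lintegral_smul_measure,
    lintegral_add_measure, lintegral_sq_gaussianReal, lintegral_sq_gaussianReal, neg_sq,
    Real.coe_toNNReal _ (by positivity), ← two_mul, smul_eq_mul, ← mul_assoc,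
    ENNReal.inv_mul_cancel two_ne_zero ofNat_ne_top, one_mul]

theorem lintegral_fst_of_isCoupling {Y : Type*} [MeasurableSpace Y] {π : Measure (Y × Y)}
    {μ ν : Measure Y} (hπ : IsCoupling π μ ν) {f : Y → ℝ≥0∞} (hf : Measurable f) :
    ∫⁻ p, f p.1 ∂π = ∫⁻ a, f a ∂μ := by
  rw [← hπ.1, lintegral_map hf measurable_fst]

theorem lintegral_snd_of_isCoupling {Y : Type*} [MeasurableSpace Y] {π : Measure (Y × Y)}
    {μ ν : Measure Y} (hπ : IsCoupling π μ ν) {f : Y → ℝ≥0∞} (hf : Measurable f) :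
    ∫⁻ p, f p.2 ∂π = ∫⁻ a, f a ∂ν := by
  rw [← hπ.2, lintegral_map hf measurable_snd]

theorem transportCost_dist_ne_top {μ ν : Measure ℝ} [IsProbabilityMeasure μ]
    [IsProbabilityMeasure ν] (hμ : ∫⁻ a, ENNReal.ofReal (a ^ 2) ∂μ ≠ ⊤)
    (hν : ∫⁻ a, ENNReal.ofReal (a ^ 2) ∂ν ≠ ⊤) :
    transportCost (fun a b => dist a b) μ ν ≠ ⊤ := by
  have hc : IsCoupling (μ.prod ν) μ ν := ⟨by simp, by simp⟩
  have hle : transportCost (fun a b => dist a b) μ ν ≤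
      ∫⁻ p : ℝ × ℝ, 2 * ENNReal.ofReal (p.1 ^ 2) + 2 * ENNReal.ofReal (p.2 ^ 2) ∂(μ.prod ν) := by
    refine iInf₂_le_of_le (μ.prod ν) hc (lintegral_mono fun p => ?_)
    simp only
    rw [← ENNReal.ofReal_ofNat 2, ← ENNReal.ofReal_mul (by norm_num),
      ← ENNReal.ofReal_mul (by norm_num), ← ENNReal.ofReal_add (by positivity) (by positivity)]
    apply ENNReal.ofReal_le_ofReal
    rw [Real.dist_eq, sq_abs]
    nlinarith [sq_nonneg (p.1 + p.2)]
  refine ne_top_of_le_ne_top ?_ hle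
  rw [lintegral_add_left (by fun_prop), lintegral_const_mul _ (by fun_prop),
    lintegral_const_mul _ (by fun_prop),
    lintegral_fst_of_isCoupling hc (f := fun a => ENNReal.ofReal (a ^ 2)) (by fun_prop),
    lintegral_snd_of_isCoupling hc (f := fun a => ENNReal.ofReal (a ^ 2)) (by fun_prop)]
  finiteness

/-- The quadratic transport cost controls the difference of the root mean squares. -/
theorem sq_sub_le_transportCost_dist {μ ν : Measure ℝ} {A B : ℝ} (hA : 0 < A) (hB : 0 < B)
    (hμ : ∫⁻ a, ENNReal.ofReal (a ^ 2) ∂μ = ENNReal.ofReal (A ^ 2))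
    (hν : ∫⁻ a, ENNReal.ofReal (a ^ 2) ∂ν = ENNReal.ofReal (B ^ 2)) :
    ENNReal.ofReal ((A - B) ^ 2) ≤ transportCost (fun a b => dist a b) μ ν := by
  refine le_iInf₂ fun π hπ => ?_
  have hfst : ∫⁻ p : ℝ × ℝ, ENNReal.ofReal (p.1 ^ 2) ∂π = ENNReal.ofReal (A ^ 2) := by
    rw [lintegral_fst_of_isCoupling hπ (f := fun a => ENNReal.ofReal (a ^ 2)) (by fun_prop), hμ]
  have hsnd : ∫⁻ p : ℝ × ℝ, ENNReal.ofReal (p.2 ^ 2) ∂π = ENNReal.ofReal (B ^ 2) := by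
    rw [lintegral_snd_of_isCoupling hπ (f := fun a => ENNReal.ofReal (a ^ 2)) (by fun_prop), hν]
  have hint : ∫⁻ p : ℝ × ℝ, ENNReal.ofReal (p.1 ^ 2) + ENNReal.ofReal (p.2 ^ 2) ∂π ≤
      ∫⁻ p : ℝ × ℝ, ENNReal.ofReal (dist p.1 p.2 ^ 2) +
        (ENNReal.ofReal (B / A) * ENNReal.ofReal (p.1 ^ 2) +
          ENNReal.ofReal (A / B) * ENNReal.ofReal (p.2 ^ 2)) ∂π := by
    refine lintegral_mono fun p => ?_
    simp only
    rw [← ENNReal.ofReal_mul (by positivity), ← ENNReal.ofReal_mul (by positivity),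
      ← ENNReal.ofReal_add (by positivity) (by positivity),
      ← ENNReal.ofReal_add (by positivity) (by positivity),
      ← ENNReal.ofReal_add (by positivity) (by positivity)]
    apply ENNReal.ofReal_le_ofReal
    rw [Real.dist_eq, sq_abs]
    have key : B / A * p.1 ^ 2 + A / B * p.2 ^ 2 - 2 * p.1 * p.2 =
        (B * p.1 - A * p.2) ^ 2 / (A * B) := by
      field_simp
      ring
    have hnn : 0 ≤ (B * p.1 - A * p.2) ^ 2 / (A * B) := by positivity
    nlinarith
  rw [lintegral_add_left (by fun_prop), lintegral_add_right _ (by fun_prop),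
    lintegral_add_left (by fun_prop), lintegral_const_mul _ (by fun_prop),
    lintegral_const_mul _ (by fun_prop), hfst, hsnd, ← ENNReal.ofReal_mul (by positivity),
    ← ENNReal.ofReal_mul (by positivity), ← ENNReal.ofReal_add (by positivity) (by positivity),
    ← ENNReal.ofReal_add (by positivity) (by positivity)] at hint
  have hcross : B / A * A ^ 2 + A / B * B ^ 2 = 2 * (A * B) := by
    field_simp
    ring
  rw [hcross, ← tsub_le_iff_right, ← ENNReal.ofReal_sub _ (by positivity)] at hint
  rwa [show (A - B) ^ 2 = A ^ 2 + B ^ 2 - 2 * (A * B) by ring]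

theorem abs_sub_le_W2_dist {μ ν : Measure ℝ} [IsProbabilityMeasure μ] [IsProbabilityMeasure ν]
    {A B : ℝ} (hA : 0 < A) (hB : 0 < B)
    (hμ : ∫⁻ a, ENNReal.ofReal (a ^ 2) ∂μ = ENNReal.ofReal (A ^ 2))
    (hν : ∫⁻ a, ENNReal.ofReal (a ^ 2) ∂ν = ENNReal.ofReal (B ^ 2)) :
    |A - B| ≤ W2 (fun a b => dist a b) μ ν := by
  have hfin : transportCost (fun a b => dist a b) μ ν ≠ ⊤ :=
    transportCost_dist_ne_top (hμ ▸ ofReal_ne_top) (hν ▸ ofReal_ne_top)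
  apply Real.abs_le_sqrt
  rw [← ENNReal.ofReal_le_iff_le_toReal hfin]
  exact sq_sub_le_transportCost_dist hA hB hμ hν

theorem mul_sqrt_sq_add_le {r s s₀ x : ℝ} (hr : 0 < r) (hs₀ : 0 < s₀) (hs : s ≤ s₀) (hx : r ≤ x) :
    r / √(r ^ 2 + s₀) * √(x ^ 2 + s) ≤ x := by
  have hx0 : 0 < x := hr.trans_le hx
  rw [div_mul_eq_mul_div, div_le_iff₀ (by positivity)]
  calc r * √(x ^ 2 + s) = √(r ^ 2 * (x ^ 2 + s)) := by
        rw [Real.sqrt_mul (by positivity), Real.sqrt_sq hr.le]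
    _ ≤ √(x ^ 2 * (r ^ 2 + s₀)) := by
        apply Real.sqrt_le_sqrt
        have hsq : r ^ 2 ≤ x ^ 2 := by gcongr
        nlinarith [mul_le_mul_of_nonneg_right hsq hs₀.le,
          mul_le_mul_of_nonneg_left hs (sq_nonneg r)]
    _ = x * √(r ^ 2 + s₀) := by
        rw [Real.sqrt_mul (by positivity), Real.sqrt_sq hx0.le]

/-- a uniform lower bound, away from the origin and for bounded times, of
the one-dimensional Wasserstein distance between symmetric Gaussian mixtures in terms of
the distance of the centers. -/
theorem stmt8 :
    ∀ t₀ > (0:ℝ), ∀ r > (0:ℝ), ∃ C > (0:ℝ), ∀ t : ℝ, 0 < t → t ≤ t₀ →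
      ∀ x y : ℝ, r ≤ x → r ≤ y →
        C * |x - y| ≤ W2 (fun a b => dist a b) (symGauss1 t x) (symGauss1 t y) := by
  intro t₀ ht₀ r hr
  refine ⟨r / √(r ^ 2 + 2 * t₀), by positivity, fun t ht htt x y hx hy => ?_⟩
  have hA : 0 < √(x ^ 2 + 2 * t) := by positivity
  have hB : 0 < √(y ^ 2 + 2 * t) := by positivity
  have hA2 : √(x ^ 2 + 2 * t) ^ 2 = x ^ 2 + 2 * t := Real.sq_sqrt (by positivity)
  have hB2 : √(y ^ 2 + 2 * t) ^ 2 = y ^ 2 + 2 * t := Real.sq_sqrt (by positivity)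
  have := isProbabilityMeasure_symGauss1 ht x
  have := isProbabilityMeasure_symGauss1 ht y
  refine le_trans ?_ (abs_sub_le_W2_dist hA hB (by rw [lintegral_sq_symGauss1 ht, hA2])
    (by rw [lintegral_sq_symGauss1 ht, hB2]))
  have h₁ := mul_sqrt_sq_add_le hr (by positivity : 0 < 2 * t₀)
    (by linarith : 2 * t ≤ 2 * t₀) hx
  have h₂ := mul_sqrt_sq_add_le hr (by positivity : 0 < 2 * t₀)
    (by linarith : 2 * t ≤ 2 * t₀) hy
  set A := √(x ^ 2 + 2 * t)
  set B := √(y ^ 2 + 2 * t)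
  refine le_of_mul_le_mul_right ?_ (add_pos hA hB)
  have hAB : |A - B| * (A + B) = |x - y| * (x + y) := by
    rw [← abs_of_pos (add_pos hA hB), ← abs_mul,
      ← abs_of_pos (add_pos (hr.trans_le hx) (hr.trans_le hy)), ← abs_mul]
    congr 1
    linear_combination hA2 - hB2
  rw [hAB, mul_right_comm, mul_comm]
  gcongr
  linarith
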